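/- In the standing setting, for every nonempty compact subset Y of X∖{∞} and every ε > 0, there exist L ≥ 1 and pairwise disjoint nonempty compact subsets Y_1, …, Y_L of Y, each of diameter less than ε, such that h_pol(f; {Y_1, …, Y_L}) = h_pol(f; Y). -/

import Mathlib

open Filter Topology Set
open scoped ENNReal

/-- `E` is `(n, ε)`-separated for `f`: any two distinct points of `E` are `ε`-apart at some
time `k ∈ {0, …, n-1}`. -/
def IsDynSeparated {X : Type*} [MetricSpace X] (f : X → X) (n : ℕ) (ε : ℝ) (E : Set X) : Prop :=
  ∀ x ∈ E, ∀ y ∈ E, x ≠ y → ∃ k < n, ε < dist (f^[k] x) (f^[k] y)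

/-- `S(n, ε)`: the maximal cardinality of an `(n, ε)`-separated set. -/
noncomputable def maxSep {X : Type*} [MetricSpace X] (f : X → X) (n : ℕ) (ε : ℝ) : ℕ :=
  sSup {m | ∃ E : Finset X, IsDynSeparated f n ε ↑E ∧ E.card = m}

/-- Polynomial entropy `h_pol(f) = lim_{ε → 0} limsup_n (log S(n,ε) / log n)`, a value in
`[0, ∞]`.  Since `ε ↦ limsup_n (log S(n,ε) / log n)` is nonincreasing in `ε`, the limit as
`ε → 0⁺` is the supremum over `ε > 0`. -/
noncomputable def polEntropy {X : Type*} [MetricSpace X] (f : X → X) : ℝ≥0∞ :=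
  ⨆ (ε : ℝ) (_ : 0 < ε),
    Filter.atTop.limsup fun n : ℕ =>
      ENNReal.ofReal (Real.log (maxSep f n ε) / Real.log n)

/-- Topological entropy `h_top(f) = lim_{ε → 0} limsup_n (1/n) log S(n,ε)`. -/
noncomputable def topEntropy {X : Type*} [MetricSpace X] (f : X → X) : ℝ≥0∞ :=
  ⨆ (ε : ℝ) (_ : 0 < ε),
    Filter.atTop.limsup fun n : ℕ =>
      ENNReal.ofReal (Real.log (maxSep f n ε) / n)

/-- The set `A_n(ℱ)` of codings of orbit segments of length `n` relative to the finite
family `ℱ`: words `w` with letters in `ℱ ∪ {∞_ℱ}` (where `∞_ℱ` is the complement of `∪ℱ`)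
for which some orbit segment `(x, f x, …, f^{n-1} x)` satisfies `f^k x ∈ w k` for all `k`. -/
def codings {X : Type*} (f : X → X) (F : Finset (Set X)) (n : ℕ) : Set (Fin n → Set X) :=
  {w | (∀ k, w k ∈ F ∨ w k = (⋃₀ (F : Set (Set X)))ᶜ) ∧
      ∃ x : X, ∀ k : Fin n, f^[(k : ℕ)] x ∈ w k}

/-- Coding polynomial entropy of a finite family: `h_pol(f; ℱ) = limsup_n log #A_n(ℱ) / log n`.
For a single set `Y`, `h_pol(f; Y)` is `codingEntropy f {Y}`. -/
noncomputable def codingEntropy {X : Type*} (f : X → X) (F : Finset (Set X)) : ℝ≥0∞ :=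
  Filter.atTop.limsup fun n : ℕ =>
    ENNReal.ofReal (Real.log ((codings f F n).ncard) / Real.log n)

/-- The `n`-th iterate of a homeomorphism, for `n : ℤ`. -/
def zIter {X : Type*} [TopologicalSpace X] (f : X ≃ₜ X) (n : ℤ) (x : X) : X :=
  (f.toEquiv ^ n) x

/-- A set `Z` is wandering if `f^n(Z) ∩ Z = ∅` for every integer `n ≠ 0`. -/
def IsWanderingSet {X : Type*} [TopologicalSpace X] (f : X ≃ₜ X) (Z : Set X) : Prop :=
  ∀ n : ℤ, n ≠ 0 → zIter f n '' Z ∩ Z = ∅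

/-- Standing setting: `p` (the point written `∞` in the paper) is a fixed point of `f`, and
every other point is wandering, i.e. has a wandering neighborhood. -/
def StandingSetting {X : Type*} [TopologicalSpace X] (f : X ≃ₜ X) (p : X) : Prop :=
  f p = p ∧ ∀ x : X, x ≠ p → ∃ U ∈ 𝓝 x, IsWanderingSet f U

/-- `M(Y) = sup_{x ∈ X} #{n ∈ ℤ : f^n(x) ∈ Y}`. -/
noncomputable def orbitCount {X : Type*} [TopologicalSpace X] (f : X ≃ₜ X) (Y : Set X) : ℕ∞ :=
  ⨆ x : X, {n : ℤ | zIter f n x ∈ Y}.encard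

/-- Local polynomial entropy `h^loc_pol(f; S)` of a finite set `S`: the limit, along
decreasing neighborhood bases of the points of `S`, of the coding entropies of the
corresponding families of neighborhoods.  By monotonicity of the coding entropy this limit
equals the infimum of `h_pol(f; {U x : x ∈ S})` over all families `U` of respective
neighborhoods of the points of `S` such that `M(⋃_{x ∈ S} U x) < ∞` (such families exist,
and any decreasing neighborhood basis eventually consists of such sets). -/
noncomputable def localEntropy {X : Type*} [TopologicalSpace X] (f : X ≃ₜ X)
    (S : Finset X) : ℝ≥0∞ :=
  letI := Classical.decEq (Set X)
  ⨅ (U : X → Set X) (_ : ∀ x ∈ S, U x ∈ 𝓝 x)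
    (_ : orbitCount f (⋃ x ∈ S, U x) < ⊤),
    codingEntropy ⇑f (S.image U)

/-- The family `U` of sets (indexed by the points of `S`) is mutually singular: for every
`M` there are a point `x` and times `(N a)_{a ∈ S}` with `f^{N a}(x) ∈ U a` for all `a ∈ S`
and `|N a - N b| > M` for all `a ≠ b` in `S`. -/
def MutuallySingularFam {X : Type*} [TopologicalSpace X] (f : X ≃ₜ X) (S : Finset X)
    (U : X → Set X) : Prop :=
  ∀ M : ℕ, ∃ (x : X) (N : X → ℤ),
    (∀ a ∈ S, zIter f (N a) x ∈ U a) ∧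
    ∀ a ∈ S, ∀ b ∈ S, a ≠ b → (M : ℤ) < |N a - N b|

/-- A finite set `S` is singular if every family of respective neighborhoods of its points
is mutually singular. -/
def IsSingularSet {X : Type*} [TopologicalSpace X] (f : X ≃ₜ X) (S : Finset X) : Prop :=
  ∀ U : X → Set X, (∀ a ∈ S, U a ∈ 𝓝 a) → MutuallySingularFam f S U

lemma limsup_ofReal_log_div_log_le {ι : Type*} (s : Finset ι) (a : ℕ → ℕ) (b : ι → ℕ → ℕ) (C : ℕ)
    (h : ∀ᶠ n in atTop, a n ≤ C * ∑ i ∈ s, b i n) :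
    (atTop.limsup fun n : ℕ => ENNReal.ofReal (Real.log (a n) / Real.log n)) ≤
      s.sup fun i => atTop.limsup fun n : ℕ =>
        ENNReal.ofReal (Real.log (b i n) / Real.log n) := by
  have hlim : Tendsto (fun n : ℕ => ENNReal.ofReal (Real.log ((C * s.card : ℕ) : ℝ) / Real.log n))
      atTop (𝓝 0) := by
    have := (Real.tendsto_log_atTop.comp tendsto_natCast_atTop_atTop).const_div_atTop
      (Real.log ((C * s.card : ℕ) : ℝ))
    simpa using ENNReal.tendsto_ofReal this
  rw [← limsup_finset_sup, ← ENNReal.limsup_add_of_left_tendsto_zero hlim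
    fun n => s.sup fun i => ENNReal.ofReal (Real.log (b i n) / Real.log n)]
  refine limsup_le_limsup ?_
  filter_upwards [h] with n hn
  rcases Nat.eq_zero_or_pos (a n) with ha | ha
  · simp [ha]
  have hs : s.Nonempty := by
    by_contra hs
    simp only [Finset.not_nonempty_iff_eq_empty.1 hs, Finset.sum_empty, mul_zero] at hn
    omega
  obtain ⟨i, hi, hmax⟩ := s.exists_max_image (fun i => b i n) hs
  have hle : a n ≤ C * s.card * b i n := by
    calc a n ≤ C * ∑ i ∈ s, b i n := hn
      _ ≤ C * (s.card * b i n) := by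
          gcongr
          simpa using Finset.sum_le_card_nsmul s (fun i => b i n) (b i n) hmax
      _ = C * s.card * b i n := by ring
  have hpos : 0 < C * s.card * b i n := ha.trans_le hle
  have hlog : Real.log (a n) ≤ Real.log ((C * s.card : ℕ) : ℝ) + Real.log (b i n) := by
    rw [← Real.log_mul (by exact_mod_cast (Nat.pos_of_mul_pos_right hpos).ne')
      (by exact_mod_cast (Nat.pos_of_mul_pos_left hpos).ne')]
    exact Real.log_le_log (by exact_mod_cast ha) (by exact_mod_cast hle)
  calc ENNReal.ofReal (Real.log (a n) / Real.log n)
      ≤ ENNReal.ofReal (Real.log ((C * s.card : ℕ) : ℝ) / Real.log n +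
          Real.log (b i n) / Real.log n) := by
        rw [← add_div]
        exact ENNReal.ofReal_le_ofReal
          (div_le_div_of_nonneg_right hlog (Real.log_natCast_nonneg n))
    _ ≤ _ := ENNReal.ofReal_add_le
    _ ≤ _ := by
        exact add_le_add_right
          (Finset.le_sup (f := fun i => ENNReal.ofReal (Real.log (b i n) / Real.log n)) hi) _

lemma Finset.exists_fin_cover {α : Type*} {S : Set α} (hS : S.Nonempty) (P : Finset α)
    (hPS : ↑P ⊆ S) {M : ℕ} (hP : P.card ≤ M) :
    ∃ y : Fin M → α, (∀ j, y j ∈ S) ∧ ∀ a ∈ P, ∃ j, y j = a := by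
  obtain ⟨s, hs⟩ := hS
  refine ⟨fun j => if h : (j : ℕ) < P.card then P.equivFin.symm ⟨j, h⟩ else s, fun j => ?_,
    fun a ha => ?_⟩
  · dsimp only
    split_ifs
    · exact hPS (Subtype.prop _)
    · exact hs
  · refine ⟨⟨P.equivFin ⟨a, ha⟩, (P.equivFin ⟨a, ha⟩).2.trans_le hP⟩, ?_⟩
    simp

lemma finite_codings {X : Type*} (f : X → X) (F : Finset (Set X)) (n : ℕ) :
    (codings f F n).Finite := by
  refine (Set.Finite.pi' (t := fun _ : Fin n => ((F : Set (Set X)) ∪ {(⋃₀ (F : Set (Set X)))ᶜ}))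
    fun _ => F.finite_toSet.union (Set.finite_singleton _)).subset fun w hw k => ?_
  simpa [or_comm] using hw.1 k

lemma exists_coding {X : Type*} (f : X → X) (F : Finset (Set X)) (n : ℕ) (x : X) :
    ∃ w ∈ codings f F n, ∀ k : Fin n, f^[(k : ℕ)] x ∈ w k := by
  have h : ∀ k : Fin n, ∃ Z : Set X, (Z ∈ F ∨ Z = (⋃₀ (F : Set (Set X)))ᶜ) ∧
      f^[(k : ℕ)] x ∈ Z := by
    intro k
    by_cases hk : f^[(k : ℕ)] x ∈ ⋃₀ (F : Set (Set X))
    · obtain ⟨Z, hZ, hxZ⟩ := hk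
      exact ⟨Z, Or.inl hZ, hxZ⟩
    · exact ⟨_, Or.inr rfl, hk⟩
  choose w hw hxw using h
  exact ⟨w, ⟨hw, x, hxw⟩, hxw⟩

lemma eq_iff_mem_of_mem_codings_singleton {X : Type*} {f : X → X} {Y : Set X} {n : ℕ}
    {v : Fin n → Set X} (hv : ∀ k, v k ∈ ({Y} : Finset (Set X)) ∨
      v k = (⋃₀ (({Y} : Finset (Set X)) : Set (Set X)))ᶜ) {x : X}
    (hx : ∀ k : Fin n, f^[(k : ℕ)] x ∈ v k) (k : Fin n) :
    v k = Y ↔ f^[(k : ℕ)] x ∈ Y := by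
  refine ⟨fun h => h ▸ hx k, fun h => ?_⟩
  rcases hv k with hk | hk
  · simpa using hk
  · have := hx k
    rw [hk] at this
    simp [h] at this

lemma ncard_codings_le_of_subset {X : Type*} (f : X → X) {Y : Set X} {M : ℕ}
    (hM : ∀ (x : X) (T : Finset ℕ), (∀ k ∈ T, f^[k] x ∈ Y) → T.card ≤ M)
    (G : Finset (Set X)) (hG : ∀ Z ∈ G, Z ⊆ Y) {n : ℕ} (hn : 0 < n) :
    (codings f G n).ncard ≤ (G.card + 1) ^ M * (codings f {Y} n).ncard := by
  classical
  have hcover : ∀ v : Fin n → Set X, ∃ t : Fin M → Fin n,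
      v ∈ codings f {Y} n → ∀ k, v k = Y → ∃ j, t j = k := by
    intro v
    by_cases hv : v ∈ codings f {Y} n
    · obtain ⟨x, hx⟩ := hv.2
      obtain ⟨t, -, ht⟩ := Finset.exists_fin_cover (S := (Set.univ : Set (Fin n)))
        ⟨⟨0, hn⟩, Set.mem_univ _⟩ (Finset.univ.filter fun k => v k = Y) (Set.subset_univ _)
        (M := M) (by
          rw [← Finset.card_map Fin.valEmbedding]
          refine hM x _ fun k hk => ?_
          simp only [Finset.mem_map, Finset.mem_filter, Finset.mem_univ, true_and] at hk
          obtain ⟨i, hi, rfl⟩ := hk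
          exact (eq_iff_mem_of_mem_codings_singleton hv.1 hx i).1 hi)
      exact ⟨t, fun _ k hk => ht k (by simpa using hk)⟩
    · exact ⟨fun _ => ⟨0, hn⟩, fun h => absurd h hv⟩
  choose t ht using hcover
  have hcoarse : ∀ w : Fin n → Set X, ∃ v : Fin n → Set X, w ∈ codings f G n →
      v ∈ codings f {Y} n ∧ ∀ k, v k ≠ Y → w k = (⋃₀ (G : Set (Set X)))ᶜ := by
    intro w
    by_cases hw : w ∈ codings f G n
    · obtain ⟨x, hx⟩ := hw.2
      obtain ⟨v, hv, hxv⟩ := exists_coding f {Y} n x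
      refine ⟨v, fun _ => ⟨hv, fun k hk => (hw.1 k).resolve_left fun hwk => hk ?_⟩⟩
      exact (eq_iff_mem_of_mem_codings_singleton hv.1 hxv k).2 (hG _ hwk (hx k))
    · exact ⟨w, fun h => absurd h hw⟩
  choose c hc using hcoarse
  let L : Finset (Set X) := insert (⋃₀ (G : Set (Set X)))ᶜ G
  let B : Finset (Fin M → Set X) := Fintype.piFinset fun _ => L
  have hB : (B : Set (Fin M → Set X)).ncard ≤ (G.card + 1) ^ M := by
    rw [Set.ncard_coe_finset, Fintype.card_piFinset_const]
    exact Nat.pow_le_pow_left (Finset.card_insert_le _ _) M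
  calc (codings f G n).ncard
      ≤ ((B : Set (Fin M → Set X)) ×ˢ codings f {Y} n).ncard := by
        refine Set.ncard_le_ncard_of_injOn (fun w => (fun j => w (t (c w) j), c w)) ?_ ?_
          (B.finite_toSet.prod (finite_codings f {Y} n))
        · refine fun w hw => ⟨?_, (hc w hw).1⟩
          simp only [B, L, Finset.mem_coe, Fintype.mem_piFinset, Finset.mem_insert]
          exact fun j => (hw.1 _).symm
        · intro w hw w' hw' h
          simp only [Prod.mk.injEq] at h
          obtain ⟨h1, h2⟩ := h
          funext k
          by_cases hk : c w k = Y
          · obtain ⟨j, hj⟩ := ht _ (hc w hw).1 k hk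
            have := congrFun h1 j
            rwa [← h2, hj] at this
          · rw [(hc w hw).2 k hk, (hc w' hw').2 k (h2 ▸ hk)]
    _ = (B : Set (Fin M → Set X)).ncard * (codings f {Y} n).ncard := Set.ncard_prod
    _ ≤ _ := Nat.mul_le_mul_right _ hB

lemma ncard_codings_singleton_le_sum {X ι : Type*} (f : X → X) {Y : Set X} (s : Finset ι)
    (G : ι → Finset (Set X)) (hG : ∀ i ∈ s, ∀ Z ∈ G i, Z ⊆ Y) (n : ℕ)
    (hs : ∀ x : X, ∃ i ∈ s, ∀ k < n, f^[k] x ∈ Y → ∃ Z ∈ G i, f^[k] x ∈ Z) :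
    (codings f {Y} n).ncard ≤ ∑ i ∈ s, (codings f (G i) n).ncard := by
  classical
  let r : ι → (Fin n → Set X) → (Fin n → Set X) :=
    fun i w k => if w k = (⋃₀ (G i : Set (Set X)))ᶜ then Yᶜ else Y
  have hsub : codings f {Y} n ⊆ ⋃ i ∈ s, r i '' codings f (G i) n := by
    rintro v ⟨hv, x, hx⟩
    obtain ⟨i, hi, hcov⟩ := hs x
    obtain ⟨w, hw, hxw⟩ := exists_coding f (G i) n x
    simp only [Set.mem_iUnion]
    refine ⟨i, hi, w, hw, ?_⟩
    funext k
    have hvk := eq_iff_mem_of_mem_codings_singleton hv hx k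
    by_cases hk : f^[(k : ℕ)] x ∈ Y
    · have hne : w k ≠ (⋃₀ (G i : Set (Set X)))ᶜ := by
        intro h
        have := hxw k
        rw [h] at this
        obtain ⟨Z, hZ, hxZ⟩ := hcov k k.2 hk
        exact this ⟨Z, hZ, hxZ⟩
      simp only [r, if_neg hne]
      exact (hvk.2 hk).symm
    · have heq : w k = (⋃₀ (G i : Set (Set X)))ᶜ :=
        (hw.1 k).resolve_left fun h => hk (hG i hi _ h (hxw k))
      simp only [r, if_pos heq]
      rcases hv k with h | h
      · exact absurd (hvk.1 (by simpa using h)) hk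
      · simpa using h.symm
  calc (codings f {Y} n).ncard
      ≤ (⋃ i ∈ s, r i '' codings f (G i) n).ncard :=
        Set.ncard_le_ncard hsub
          (s.finite_toSet.biUnion fun i _ => (finite_codings f (G i) n).image _)
    _ ≤ ∑ i ∈ s, (r i '' codings f (G i) n).ncard := Finset.set_ncard_biUnion_le _ _
    _ ≤ _ := Finset.sum_le_sum fun i _ => Set.ncard_image_le (finite_codings f (G i) n)

lemma IsWanderingSet.eq_of_iterate_mem {X : Type*} [TopologicalSpace X] {f : X ≃ₜ X} {U : Set X}
    (hU : IsWanderingSet f U) {x : X} {k l : ℕ} (hk : f^[k] x ∈ U) (hl : f^[l] x ∈ U) :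
    k = l := by
  wlog hkl : k ≤ l generalizing k l
  · exact (this hl hk (le_of_not_ge hkl)).symm
  by_contra hne
  have hd : ((l - k : ℕ) : ℤ) ≠ 0 := by omega
  have hmem : f^[l] x ∈ zIter f ((l - k : ℕ) : ℤ) '' U ∩ U := by
    refine ⟨⟨f^[k] x, hk, ?_⟩, hl⟩
    change (f.toEquiv ^ ((l - k : ℕ) : ℤ)) (f^[k] x) = f^[l] x
    rw [zpow_natCast, ← Equiv.Perm.iterate_eq_pow]
    change f^[l - k] (f^[k] x) = f^[l] x
    rw [← Function.iterate_add_apply, Nat.sub_add_cancel hkl]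
  rw [hU _ hd] at hmem
  exact hmem

lemma StandingSetting.exists_card_visits_le {X : Type*} [TopologicalSpace X] {f : X ≃ₜ X} {p : X}
    (hst : StandingSetting f p) {Y : Set X} (hYc : IsCompact Y) (hYp : p ∉ Y) :
    ∃ M : ℕ, ∀ (x : X) (T : Finset ℕ), (∀ k ∈ T, f^[k] x ∈ Y) → T.card ≤ M := by
  classical
  have hW : ∀ y : X, ∃ U : Set X, y ∈ Y → U ∈ 𝓝 y ∧ IsWanderingSet f U := by
    intro y
    by_cases hy : y = p
    · exact ⟨∅, fun h => absurd (hy ▸ h) hYp⟩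
    · obtain ⟨U, hU⟩ := hst.2 y hy
      exact ⟨U, fun _ => hU⟩
  choose U hU using hW
  obtain ⟨s, hsY, hs⟩ := hYc.elim_nhds_subcover U fun y hy => (hU y hy).1
  refine ⟨s.card, fun x T hT => ?_⟩
  have hex : ∀ k ∈ T, ∃ y ∈ s, f^[k] x ∈ U y := fun k hk => by
    simpa using hs (hT k hk)
  have : Nonempty X := ⟨x⟩
  choose! g hgs hg using hex
  refine Finset.card_le_card_of_injOn g hgs fun k hk l hl hkl => ?_
  exact (hU _ (hsY _ (hgs k hk))).2.eq_of_iterate_mem (hg k hk) (hkl ▸ hg l hl)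

lemma exists_radius_closedBall_disjoint {X ι : Type*} [MetricSpace X] [Finite ι] (z : ι → X)
    {ε : ℝ} (hε : 0 < ε) :
    ∃ r > 0, 2 * r < ε ∧ ∀ i j, z i ≠ z j →
      Disjoint (Metric.closedBall (z i) r) (Metric.closedBall (z j) r) := by
  have hlt : ∀ c : ℝ, 0 < c → ∀ᶠ r : ℝ in 𝓝[>] 0, 2 * r < c := fun c hc => by
    filter_upwards [Ioo_mem_nhdsGT (half_pos hc)] with r hr
    linarith [hr.2]
  have hdisj : ∀ᶠ r : ℝ in 𝓝[>] 0, ∀ i j, z i ≠ z j →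
      Disjoint (Metric.closedBall (z i) r) (Metric.closedBall (z j) r) := by
    refine eventually_all.2 fun i => eventually_all.2 fun j => ?_
    by_cases hij : z i = z j
    · exact Eventually.of_forall fun r h => absurd hij h
    · filter_upwards [hlt _ (dist_pos.2 hij)] with r hr _
      exact Metric.closedBall_disjoint_closedBall (by linarith)
  obtain ⟨r, ⟨hr, hrε⟩, hrd⟩ := ((eventually_mem_nhdsWithin.and (hlt ε hε)).and hdisj).exists
  exact ⟨r, hr, hrε, hrd⟩

/-- cutting a compact set into finitely many pairwise disjoint small compact
pieces without changing the coding entropy. -/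
theorem codingEntropy_cut_compact {X : Type*} [MetricSpace X] [CompactSpace X]
    (f : X ≃ₜ X) (p : X) (hst : StandingSetting f p)
    (Y : Set X) (hYne : Y.Nonempty) (hYc : IsCompact Y) (hYp : p ∉ Y)
    (ε : ℝ) (hε : 0 < ε) :
    ∃ G : Finset (Set X), G.Nonempty ∧
      (∀ Z ∈ G, Z.Nonempty ∧ IsCompact Z ∧ Z ⊆ Y ∧ Metric.diam Z < ε) ∧
      ((G : Set (Set X)).Pairwise Disjoint) ∧
      codingEntropy ⇑f G = codingEntropy ⇑f {Y} := by
  classical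
  obtain ⟨M, hM⟩ := hst.exists_card_visits_le hYc hYp
  choose r hr0 hrε hrd using fun z : Fin (M + 1) → X => exists_radius_closedBall_disjoint z hε
  let K : (Fin (M + 1) → X) → Fin (M + 1) → Set X := fun z j => Y ∩ Metric.closedBall (z j) (r z)
  let G : (Fin (M + 1) → X) → Finset (Set X) := fun z => Finset.univ.image (K z)
  have hGY : ∀ z, ∀ Z ∈ G z, Z ⊆ Y := by
    intro z Z hZ
    obtain ⟨j, -, rfl⟩ := Finset.mem_image.1 hZ
    exact Set.inter_subset_left
  obtain ⟨s, hsY, hs⟩ := (isCompact_univ_pi fun _ : Fin (M + 1) => hYc).elim_nhds_subcover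
    (fun z => Set.univ.pi fun j => Metric.closedBall (z j) (r z))
    (fun z _ => set_pi_mem_nhds Set.finite_univ fun j _ => Metric.closedBall_mem_nhds _ (hr0 z))
  have hcov : ∀ (n : ℕ) (x : X), ∃ z ∈ s, ∀ k < n, f^[k] x ∈ Y → ∃ Z ∈ G z, f^[k] x ∈ Z := by
    intro n x
    let T : Finset ℕ := (Finset.range n).filter fun k => f^[k] x ∈ Y
    obtain ⟨y, hyY, hy⟩ := Finset.exists_fin_cover hYne (T.image fun k => f^[k] x)
      (fun a ha => by
        obtain ⟨k, hk, rfl⟩ := Finset.mem_image.1 (Finset.mem_coe.1 ha)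
        exact (Finset.mem_filter.1 hk).2)
      (M := M + 1)
      ((Finset.card_image_le.trans (hM x T fun k hk => (Finset.mem_filter.1 hk).2)).trans
        (Nat.le_succ M))
    obtain ⟨z, hz, hyz⟩ := Set.mem_iUnion₂.1 (hs fun j _ => hyY j)
    refine ⟨z, hz, fun k hk hkY => ?_⟩
    obtain ⟨j, hj⟩ := hy (f^[k] x) (Finset.mem_image_of_mem _
      (Finset.mem_filter.2 ⟨Finset.mem_range.2 hk, hkY⟩))
    exact ⟨K z j, Finset.mem_image_of_mem _ (Finset.mem_univ j), hkY,
      hj ▸ hyz j (Set.mem_univ j)⟩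
  have hsne : s.Nonempty := by
    obtain ⟨y, -⟩ := hYne
    obtain ⟨z, hz, -⟩ := hcov 0 y
    exact ⟨z, hz⟩
  have hle : codingEntropy f {Y} ≤ s.sup fun z => codingEntropy f (G z) :=
    limsup_ofReal_log_div_log_le s (fun n => (codings f {Y} n).ncard)
      (fun z n => (codings f (G z) n).ncard) 1 <| Eventually.of_forall fun n => by
        rw [one_mul]
        exact ncard_codings_singleton_le_sum f s G (fun z _ => hGY z) n (hcov n)
  obtain ⟨z, hz, hzs⟩ := s.exists_mem_eq_sup hsne fun z => codingEntropy f (G z)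
  have hge : codingEntropy f (G z) ≤ codingEntropy f {Y} := by
    have := limsup_ofReal_log_div_log_le {()} (fun n => (codings f (G z) n).ncard)
      (fun _ n => (codings f {Y} n).ncard) (((G z).card + 1) ^ M) <| by
        filter_upwards [eventually_gt_atTop 0] with n hn
        simpa using ncard_codings_le_of_subset f hM (G z) (hGY z) hn
    simpa [codingEntropy] using this
  refine ⟨G z, Finset.univ_nonempty.image _, fun Z hZ => ?_, ?_, hge.antisymm (hzs ▸ hle)⟩
  · refine ⟨?_, ?_, hGY z Z hZ, ?_⟩ <;> obtain ⟨j, -, rfl⟩ := Finset.mem_image.1 hZ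
    · exact ⟨z j, hsY z hz j (Set.mem_univ j), Metric.mem_closedBall_self (hr0 z).le⟩
    · exact hYc.inter_right Metric.isClosed_closedBall
    · exact ((Metric.diam_mono Set.inter_subset_right Metric.isBounded_closedBall).trans
        (Metric.diam_closedBall (hr0 z).le)).trans_lt (hrε z)
  · intro A hA B hB hAB
    obtain ⟨i, -, rfl⟩ := Finset.mem_image.1 (Finset.mem_coe.1 hA)
    obtain ⟨j, -, rfl⟩ := Finset.mem_image.1 (Finset.mem_coe.1 hB)
    refine (hrd z i j fun h => hAB ?_).mono Set.inter_subset_right Set.inter_subset_right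
    simp only [K, h]
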